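/- For all positive integers g, m and every integer j ≥ 1, there exists a nonzero real polynomial u of degree j−1 such that the function ξ(x) = u(tanh x)/cosh x satisfies, for all x ∈ ℝ, the equation ξ''(x) − (m−1) tanh x·ξ'(x) − m tanh²x·ξ(x) + (λ_j + m − m/g)·ξ(x)/cosh²x = 0, where λ_j = j(j+m) + m/g − 2m. (The polynomial u may be taken to be the Gegenbauer polynomial C_{j−1}^{((m+2)/2)}.) -/

import Mathlib

open Real

open Polynomial in
/-- The Gegenbauer equation `(1 - X²) u'' - c X u' + n (n + c - 1) u = 0` has a polynomial
solution of degree exactly `n`. -/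
theorem exists_polynomial_gegenbauer (n : ℕ) :
    ∀ c : ℝ, 0 < c → ∃ u : ℝ[X], u ≠ 0 ∧ u.natDegree = n ∧
      (1 - X ^ 2) * derivative (derivative u) - C c * X * derivative u
        + C ((n : ℝ) * (n + c - 1)) * u = 0 := by
  induction n with
  | zero => exact fun c _ => ⟨1, one_ne_zero, natDegree_one, by simp⟩
  | succ n ih =>
    intro c hc
    obtain ⟨u, hu0, hun, hu⟩ := ih (c + 2) (by linarith)
    set v : ℝ[X] := (1 - X ^ 2) * derivative u - C c * X * u with hv
    have hk : (-(((n : ℝ) + 1) * (n + c))) ≠ 0 := neg_ne_zero.mpr (by positivity)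
    have hv' : derivative v = C (-(((n : ℝ) + 1) * (n + c))) * u := by
      simp only [hv, derivative_sub, derivative_mul, derivative_one, derivative_X_pow,
        derivative_C, derivative_X]
      simp only [map_neg, map_mul, map_add, map_sub, map_one, map_natCast, map_ofNat] at hu ⊢
      push_cast
      norm_num
      linear_combination hu
    have hv'0 : derivative v ≠ 0 := by
      rw [hv']
      exact mul_ne_zero (C_ne_zero.mpr hk) hu0
    have hdeg : (derivative v).natDegree = n := by
      rw [hv', natDegree_C_mul hk, hun]
    refine ⟨v, fun h => hv'0 (by rw [h, derivative_zero]), ?_, ?_⟩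
    · have h0 : v.natDegree ≠ 0 := fun h => hv'0 (derivative_of_natDegree_zero h)
      rw [natDegree_derivative] at hdeg
      omega
    · rw [hv', derivative_C_mul, hv]
      simp only [map_neg, map_mul, map_add, map_sub, map_one, map_natCast, Nat.cast_succ]
      ring

theorem tanh_hasDerivAt (x : ℝ) : HasDerivAt tanh (1 - tanh x ^ 2) x := by
  have hc := (cosh_pos x).ne'
  have h := (hasDerivAt_sinh x).div (hasDerivAt_cosh x) hc
  have e : tanh = fun y => sinh y / cosh y := funext tanh_eq_sinh_div_cosh
  rw [e]
  refine h.congr_deriv ?_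
  field_simp

/-- `tanh` solves the Riccati equation, so derivatives of `p(tanh x) / cosh x` stay in this
form. -/
theorem hasDerivAt_eval_tanh_div_cosh (p : Polynomial ℝ) (x : ℝ) :
    HasDerivAt (fun y : ℝ => p.eval (tanh y) / cosh y)
      (((1 - Polynomial.X ^ 2) * p.derivative - Polynomial.X * p).eval (tanh x) / cosh x) x := by
  have hc := (cosh_pos x).ne'
  have h1 : HasDerivAt (fun y : ℝ => p.eval (tanh y)) _ x :=
    (p.hasDerivAt (tanh x)).comp x (tanh_hasDerivAt x)
  refine (h1.div (hasDerivAt_cosh x) hc).congr_deriv ?_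
  have hs : sinh x = tanh x * cosh x := by rw [tanh_eq_sinh_div_cosh]; field_simp
  rw [hs]
  simp only [Polynomial.eval_sub, Polynomial.eval_mul, Polynomial.eval_one, Polynomial.eval_pow,
    Polynomial.eval_X]
  field_simp

/-- For every `j ≥ 1` there is a nonzero polynomial `u` of degree `j - 1` such that
`ξ(x) = u(tanh x)/cosh x` is an eigenfunction of the Jacobi operator of the harmonic
self-map of `SO(2gm+2)` associated with `r(t) = (1-2g)t`, with eigenvalue
`λ_j = j(j+m) + m/g - 2m`. -/
theorem spectrum_so_linear (g m : ℕ) (hg : 0 < g) (hm : 0 < m)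
    (j : ℕ) (hj : 1 ≤ j) :
    ∃ u : Polynomial ℝ, u ≠ 0 ∧ u.natDegree = j - 1 ∧
      ∀ x : ℝ,
        deriv (deriv (fun y : ℝ => u.eval (tanh y) / cosh y)) x
        - ((m : ℝ) - 1) * tanh x * deriv (fun y : ℝ => u.eval (tanh y) / cosh y) x
        - (m : ℝ) * tanh x ^ 2 * (u.eval (tanh x) / cosh x)
        + ((j * (j + (m : ℝ)) + (m : ℝ) / g - 2 * m) + (m : ℝ) - (m : ℝ) / g)
            * (u.eval (tanh x) / cosh x) / cosh x ^ 2 = 0 := by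
  obtain ⟨n, rfl⟩ : ∃ n, j = n + 1 := ⟨j - 1, by omega⟩
  obtain ⟨u, hu0, hun, hu⟩ := exists_polynomial_gegenbauer n ((m : ℝ) + 3) (by positivity)
  refine ⟨u, hu0, by simpa using hun, fun x => ?_⟩
  have hd (p : Polynomial ℝ) := funext fun x => (hasDerivAt_eval_tanh_div_cosh p x).deriv
  rw [hd, hd]
  have hsech : 1 / cosh x ^ 2 = 1 - tanh x ^ 2 := by
    have hc := (cosh_pos x).ne'
    rw [tanh_eq_sinh_div_cosh]
    field_simp
    linarith [cosh_sq x]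
  have hx := congrArg (Polynomial.eval (tanh x)) hu
  rw [div_eq_mul_one_div _ (cosh x ^ 2), hsech]
  simp only [Polynomial.derivative_sub, Polynomial.derivative_mul, Polynomial.derivative_one,
    Polynomial.derivative_X_pow, Polynomial.derivative_X, Polynomial.eval_sub,
    Polynomial.eval_add, Polynomial.eval_mul, Polynomial.eval_one, Polynomial.eval_pow,
    Polynomial.eval_X, Polynomial.eval_C, Polynomial.eval_zero] at hx ⊢
  push_cast
  norm_num
  linear_combination ((1 - tanh x ^ 2) / cosh x) * hx
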